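/- Let A_1, …, A_k ∈ M_n(ℂ) be accretive matrices with 0 < m·I_n ≤ Re(A_i) ≤ M·I_n for all i, where 0 < m ≤ M and h = M/m. Then for every normalized positive multilinear map Φ : M_n(ℂ)^k → M_l(ℂ), one has (Φ(Re(A_1^{-1}), …, Re(A_k^{-1})))² ≤ K(h^k)² · (Φ(Re A_1, …, Re A_k))^{-2} in the Loewner order. -/

import Mathlib

open Matrix
open scoped ComplexOrder

/-- The real (Hermitian) part of a complex matrix: `Re A = (A + Aᴴ)/2`. -/
noncomputable def matRe {n : ℕ} (A : Matrix (Fin n) (Fin n) ℂ) : Matrix (Fin n) (Fin n) ℂ :=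
  (2⁻¹ : ℂ) • (A + Aᴴ)

/-- `A` is a sector matrix of angle `α`: its numerical range is contained in
`S_α = {z : Re z > 0, |Im z| ≤ tan α · Re z}`. -/
def InSector {n : ℕ} (α : ℝ) (A : Matrix (Fin n) (Fin n) ℂ) : Prop :=
  ∀ x : Fin n → ℂ, star x ⬝ᵥ x = 1 →
    0 < (star x ⬝ᵥ A *ᵥ x).re ∧
      |(star x ⬝ᵥ A *ᵥ x).im| ≤ Real.tan α * (star x ⬝ᵥ A *ᵥ x).re

/-- The Kantorovich constant `K(x) = (x+1)²/(4x)`. -/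
noncomputable def kant (x : ℝ) : ℝ := (x + 1) ^ 2 / (4 * x)


noncomputable def rip {l : ℕ} (x y : Fin l → ℂ) : ℝ := (star x ⬝ᵥ y).re

lemma rip_comm {l : ℕ} (x y : Fin l → ℂ) : rip x y = rip y x := by
  unfold rip
  have : star x ⬝ᵥ y = star (star y ⬝ᵥ x) := by
    rw [← star_dotProduct_star, star_star, dotProduct_comm]
  rw [this]; simp

lemma rip_add_left {l : ℕ} (x y z : Fin l → ℂ) : rip (x + y) z = rip x z + rip y z := by
  simp [rip, star_add, add_dotProduct]

lemma rip_add_right {l : ℕ} (x y z : Fin l → ℂ) : rip z (x + y) = rip z x + rip z y := by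
  simp [rip, dotProduct_add]

lemma rip_smul_right {l : ℕ} (c : ℝ) (x z : Fin l → ℂ) : rip z (c • x) = c * rip z x := by
  simp [rip, dotProduct_smul]

lemma rip_smul_left {l : ℕ} (c : ℝ) (x z : Fin l → ℂ) : rip (c • x) z = c * rip x z := by
  rw [rip_comm, rip_smul_right, rip_comm]

lemma rip_neg_right {l : ℕ} (x z : Fin l → ℂ) : rip z (-x) = - rip z x := by
  simp [rip]

lemma rip_herm {l : ℕ} {A : Matrix (Fin l) (Fin l) ℂ} (hA : A.IsHermitian) (x y : Fin l → ℂ) :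
    rip x (A *ᵥ y) = rip (A *ᵥ x) y := by
  unfold rip
  rw [star_mulVec, hA.eq, dotProduct_mulVec]

lemma rip_nonneg {l : ℕ} {A : Matrix (Fin l) (Fin l) ℂ} (hA : A.PosSemidef) (x : Fin l → ℂ) :
    0 ≤ rip x (A *ᵥ x) := (Complex.le_def.mp (hA.dotProduct_mulVec_nonneg x)).1

lemma key_vec {l : ℕ} {A B : Matrix (Fin l) (Fin l) ℂ} (hA : A.PosSemidef) (hB : B.PosSemidef)
    (hAB : ((2 : ℝ) • (1 : Matrix (Fin l) (Fin l) ℂ) - A - B).PosSemidef) (x y : Fin l → ℂ) (σ : ℝ)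
    (h1 : B *ᵥ (A *ᵥ x) = σ • y) (h2 : A *ᵥ (B *ᵥ y) = σ • x) :
    σ * (rip x (A *ᵥ x) + rip y (B *ᵥ y)) ≤ rip x (A *ᵥ x) + rip y (B *ᵥ y) := by
  set p := A *ᵥ x with hp
  set q := B *ᵥ y with hq
  have e1 := rip_nonneg hAB (p + q)
  have e2 := rip_nonneg hA (p + (-1 : ℝ) • q)
  have e3 := rip_nonneg hB (p + (-1 : ℝ) • q)
  have e4 := rip_nonneg hA ((p + q) + (-2 : ℝ) • x)
  have e5 := rip_nonneg hB ((p + q) + (-2 : ℝ) • y)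
  have c1 : rip p (A *ᵥ q) = σ * rip x p := by rw [h2, rip_smul_right, rip_comm]
  have c2 : rip q (A *ᵥ p) = σ * rip x p := by
    rw [rip_herm hA.1, h2, rip_smul_left]
  have c3 : rip p (B *ᵥ q) = σ * rip y q := by
    rw [rip_herm hB.1, h1, rip_smul_left]
  have c4 : rip q (B *ᵥ p) = σ * rip y q := by rw [h1, rip_smul_right, rip_comm]
  have c5 : ∀ z, rip x (A *ᵥ z) = rip z p := fun z => by rw [rip_herm hA.1, rip_comm]
  have c6 : ∀ z, rip y (B *ᵥ z) = rip z q := fun z => by rw [rip_herm hB.1, rip_comm]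
  have c7 := rip_comm p q
  simp only [sub_eq_add_neg, add_mulVec, neg_mulVec, smul_mulVec, one_mulVec, mulVec_add,
    mulVec_smul, rip_add_left, rip_add_right, rip_smul_left, rip_smul_right,
    rip_neg_right, ← hp, ← hq, c1, c2, c3, c4, c5, c6] at e1 e2 e3 e4 e5 ⊢
  have c8 := rip_comm p x
  have c9 := rip_comm q y
  rw [c7] at *
  linarith

lemma key {l : ℕ} {A B : Matrix (Fin l) (Fin l) ℂ} (hA : A.PosSemidef) (hB : B.PosSemidef)
    (hAB : ((2 : ℝ) • (1 : Matrix (Fin l) (Fin l) ℂ) - A - B).PosSemidef) :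
    (1 - A * B ^ 2 * A).PosSemidef := by
  have hH : (1 - A * B ^ 2 * A).IsHermitian := by
    have := (hB.pow 2).1
    rw [IsHermitian, conjTranspose_sub, conjTranspose_mul, conjTranspose_mul, this.eq, hA.1.eq,
      conjTranspose_one, Matrix.mul_assoc]
  rw [hH.posSemidef_iff_eigenvalues_nonneg]
  intro j
  by_contra hneg
  simp only [Pi.zero_apply, not_le] at hneg
  have hx0 : (⇑(hH.eigenvectorBasis j) : Fin l → ℂ) ≠ 0 := by
    intro h
    apply hH.eigenvectorBasis.toBasis.ne_zero j
    simpa using h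
  have hx := hH.mulVec_eigenvectorBasis j
  set ν := hH.eigenvalues j
  generalize (⇑(hH.eigenvectorBasis j) : Fin l → ℂ) = x at hx hx0
  have hx' : A *ᵥ (B *ᵥ (B *ᵥ (A *ᵥ x))) = (1 - ν) • x := by
    rw [sub_mulVec, one_mulVec, pow_two] at hx
    simp only [mulVec_mulVec]
    rw [sub_smul, one_smul, ← hx]
    simp [Matrix.mul_assoc]
  set σ := Real.sqrt (1 - ν) with hσ
  have hσ2 : σ * σ = 1 - ν := Real.mul_self_sqrt (by linarith)
  have hσ1 : 1 < σ := by
    rw [hσ]; apply Real.lt_sqrt_of_sq_lt; linarith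
  have hσ0 : σ ≠ 0 := by linarith
  have hk := key_vec hA hB hAB x (σ⁻¹ • (B *ᵥ (A *ᵥ x))) σ
    (by rw [smul_smul, mul_inv_cancel₀ hσ0, one_smul])
    (by rw [mulVec_smul, mulVec_smul, hx', smul_smul, ← hσ2, ← mul_assoc, inv_mul_cancel₀ hσ0,
      one_mul])
  have n1 := rip_nonneg hA x
  have n2 := rip_nonneg hB (σ⁻¹ • (B *ᵥ (A *ᵥ x)))
  have z : rip x (A *ᵥ x) = 0 := by nlinarith
  have z' : star x ⬝ᵥ (A *ᵥ x) = 0 := by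
    have := Complex.le_def.mp (hA.dotProduct_mulVec_nonneg x)
    exact Complex.ext z this.2.symm
  rw [hA.dotProduct_mulVec_zero_iff] at z'
  rw [z'] at hx'
  simp only [mulVec_zero] at hx'
  have := hx'.symm
  rw [smul_eq_zero] at this
  rcases this with h | h
  · linarith
  · exact hx0 h

lemma spec {n : ℕ} {X : Matrix (Fin n) (Fin n) ℂ} {m M : ℝ} (hm : 0 < m)
    (h1 : (X - m • 1).PosSemidef) (h2 : (M • (1 : Matrix (Fin n) (Fin n) ℂ) - X).PosSemidef)
    (hX : X.IsHermitian) :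
    ∃ (d : Fin n → ℝ) (P : Fin n → Matrix (Fin n) (Fin n) ℂ),
      (∀ j, (P j).PosSemidef) ∧ (∀ j, m ≤ d j ∧ d j ≤ M) ∧ 1 = ∑ j, P j ∧
      X = ∑ j, (d j : ℂ) • P j ∧ X⁻¹ = ∑ j, ((d j)⁻¹ : ℂ) • P j := by
  set U : Matrix (Fin n) (Fin n) ℂ := (hX.eigenvectorUnitary).1 with hU
  have hUU : U * Uᴴ = 1 := Unitary.coe_mul_star_self hX.eigenvectorUnitary
  have hUU' : Uᴴ * U = 1 := Unitary.coe_star_mul_self hX.eigenvectorUnitary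
  have hs : X = U * diagonal (fun j => (hX.eigenvalues j : ℂ)) * Uᴴ := hX.spectral_theorem
  have hD : Uᴴ * X * U = diagonal (fun j => (hX.eigenvalues j : ℂ)) := by
    generalize diagonal (fun j => (hX.eigenvalues j : ℂ)) = D at hs
    rw [hs]
    calc _ = (Uᴴ * U) * D * (Uᴴ * U) := by simp only [Matrix.mul_assoc]
      _ = D := by rw [hUU']; simp
  have sum_form : ∀ f : Fin n → ℂ, ∑ j, f j • (U * single j j 1 * Uᴴ) = U * diagonal f * Uᴴ := by
    intro f
    have hdf : diagonal f = ∑ j, single j j (f j) := by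
      ext a b
      rw [Matrix.sum_apply]
      by_cases h : a = b
      · subst h; simp [single_apply]
      · rw [diagonal_apply_ne _ h, Finset.sum_eq_zero]
        intro j _
        rw [single_apply, if_neg]
        rintro ⟨rfl, rfl⟩
        exact h rfl
    rw [hdf, Matrix.mul_sum, Matrix.sum_mul]
    refine Finset.sum_congr rfl fun j _ => ?_
    rw [← Matrix.smul_mul, ← Matrix.mul_smul, smul_single, smul_eq_mul, mul_one]
  have hb : ∀ j, m ≤ hX.eigenvalues j ∧ hX.eigenvalues j ≤ M := by
    intro j
    constructor
    · have := h1.conjTranspose_mul_mul_same U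
      rw [Matrix.mul_sub, Matrix.sub_mul, hD, Matrix.mul_smul, Matrix.smul_mul, Matrix.mul_one,
        hUU', ← diagonal_one, ← diagonal_smul, diagonal_sub, posSemidef_diagonal_iff] at this
      have := (Complex.le_def.mp (this j)).1
      simpa using this
    · have := h2.conjTranspose_mul_mul_same U
      rw [Matrix.mul_sub, Matrix.sub_mul, hD, Matrix.mul_smul, Matrix.smul_mul, Matrix.mul_one,
        hUU', ← diagonal_one, ← diagonal_smul, diagonal_sub, posSemidef_diagonal_iff] at this
      have := (Complex.le_def.mp (this j)).1
      simpa using this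
  refine ⟨hX.eigenvalues, fun j => U * single j j 1 * Uᴴ, ?_, hb, ?_, ?_, ?_⟩
  · intro j
    apply PosSemidef.mul_mul_conjTranspose_same
    rw [← diagonal_single, posSemidef_diagonal_iff]
    intro i
    by_cases h : i = j
    · subst h; simp
    · simp [h]
  · have := sum_form (fun _ => 1)
    simp only [one_smul] at this
    rw [this, diagonal_one, Matrix.mul_one, hUU]
  · rw [sum_form]; exact hs
  · rw [sum_form]
    apply inv_eq_right_inv
    have : diagonal (fun j => (hX.eigenvalues j : ℂ)) *
        diagonal (fun j => ((hX.eigenvalues j)⁻¹ : ℂ)) = 1 := by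
      rw [diagonal_mul_diagonal, ← diagonal_one]
      congr 1; ext j
      have : (hX.eigenvalues j : ℂ) ≠ 0 := by
        have := (hb j).1
        exact_mod_cast (by linarith : hX.eigenvalues j ≠ 0)
      exact mul_inv_cancel₀ this
    generalize diagonal (fun j => ((hX.eigenvalues j)⁻¹ : ℂ)) = E at this
    generalize diagonal (fun j => (hX.eigenvalues j : ℂ)) = D at hs this
    rw [hs]
    calc _ = U * (D * ((Uᴴ * U) * E)) * Uᴴ := by simp only [Matrix.mul_assoc]
      _ = 1 := by rw [hUU', Matrix.one_mul, this, Matrix.mul_one, hUU]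

lemma matRe_inv {n : ℕ} {A : Matrix (Fin n) (Fin n) ℂ} (hA : (matRe A).PosDef) :
    (matRe A⁻¹).PosSemidef ∧ ((matRe A)⁻¹ - matRe A⁻¹).PosSemidef := by
  have hu : IsUnit A := by
    rw [isUnit_iff_isUnit_det, isUnit_iff_ne_zero]
    intro h0
    obtain ⟨v, hv, hv0⟩ := exists_mulVec_eq_zero_iff.mpr h0
    have := hA.dotProduct_mulVec_pos hv
    have h2 : star v ⬝ᵥ (Aᴴ *ᵥ v) = 0 := by
      rw [dotProduct_mulVec, ← star_mulVec, hv0]; simp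
    rw [matRe, smul_mulVec, add_mulVec, hv0, zero_add, dotProduct_smul, h2] at this
    simp at this
  have hd : IsUnit A.det := (isUnit_iff_isUnit_det A).mp hu
  have hd' : IsUnit Aᴴ.det := by rw [det_conjTranspose]; exact hd.star
  have hX : IsUnit (matRe A).det := (isUnit_iff_isUnit_det _).mp hA.isUnit
  have hXh := hA.1.eq
  have hAX : A + Aᴴ = (2 : ℂ) • matRe A := by simp [matRe, smul_smul]
  set X := matRe A with hXdef
  have e1 : matRe A⁻¹ = A⁻¹ * X * (A⁻¹)ᴴ := by
    rw [hXdef, matRe, matRe, conjTranspose_nonsing_inv, Matrix.mul_smul, Matrix.smul_mul,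
      Matrix.mul_add, Matrix.add_mul, nonsing_inv_mul _ hd, Matrix.mul_assoc A⁻¹,
      mul_nonsing_inv _ hd', Matrix.one_mul, Matrix.mul_one, add_comm]
  refine ⟨by rw [e1]; exact hA.posSemidef.mul_mul_conjTranspose_same _, ?_⟩
  have e2 : X⁻¹ - matRe A⁻¹ = (A⁻¹ * (A - X)) * X⁻¹ * (A⁻¹ * (A - X))ᴴ := by
    rw [e1, conjTranspose_mul, conjTranspose_sub, hXh, conjTranspose_nonsing_inv]
    have hA' : Aᴴ = (2 : ℂ) • X - A := by rw [← hAX]; abel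
    have i1 : A⁻¹ * (A - X) = 1 - A⁻¹ * X := by rw [Matrix.mul_sub, nonsing_inv_mul _ hd]
    have i2 : (Aᴴ - X) * (Aᴴ)⁻¹ = 1 - X * (Aᴴ)⁻¹ := by
      rw [Matrix.sub_mul, mul_nonsing_inv _ hd']
    rw [i1, i2]
    have i3 : (1 - A⁻¹ * X) * X⁻¹ * (1 - X * (Aᴴ)⁻¹) = X⁻¹ - A⁻¹ - (Aᴴ)⁻¹ + A⁻¹ * X * (Aᴴ)⁻¹ := by
      have j1 : (1 - A⁻¹ * X) * X⁻¹ = X⁻¹ - A⁻¹ := by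
        rw [Matrix.sub_mul, Matrix.one_mul, Matrix.mul_assoc, mul_nonsing_inv _ hX, Matrix.mul_one]
      rw [j1, Matrix.mul_sub, Matrix.mul_one, Matrix.sub_mul, ← Matrix.mul_assoc,
        nonsing_inv_mul _ hX, Matrix.one_mul, Matrix.mul_assoc]
      abel
    rw [i3]
    have i4 : A⁻¹ + (Aᴴ)⁻¹ = (2 : ℂ) • (A⁻¹ * X * (Aᴴ)⁻¹) := by
      rw [← conjTranspose_nonsing_inv, ← e1, matRe, smul_smul]; simp
    rw [two_smul] at i4
    have : X⁻¹ - A⁻¹ - (Aᴴ)⁻¹ = X⁻¹ - (A⁻¹ + (Aᴴ)⁻¹) := by abel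
    rw [this, i4]; abel
  rw [e2]
  exact hA.posSemidef.inv.mul_mul_conjTranspose_same _

lemma mono {n l k : ℕ} (Φ : MultilinearMap ℂ (fun _ : Fin k => Matrix (Fin n) (Fin n) ℂ)
      (Matrix (Fin l) (Fin l) ℂ))
    (hΦpos : ∀ X : Fin k → Matrix (Fin n) (Fin n) ℂ,
      (∀ i, (X i).PosSemidef) → (Φ X).PosSemidef)
    (Y Z : Fin k → Matrix (Fin n) (Fin n) ℂ) (hY : ∀ i, (Y i).PosSemidef)
    (hZ : ∀ i, (Z i - Y i).PosSemidef) : (Φ Z - Φ Y).PosSemidef := by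
  have : Z = Y + (Z - Y) := by abel
  rw [this, Φ.map_add_univ, ← Finset.add_sum_erase _ _ (Finset.mem_univ Finset.univ),
    Finset.piecewise_univ, add_sub_cancel_left]
  apply posSemidef_sum
  intro s _
  apply hΦpos
  intro i
  by_cases h : i ∈ s
  · simpa [h] using hY i
  · simpa [h] using hZ i

lemma expand {n l k : ℕ} (Φ : MultilinearMap ℂ (fun _ : Fin k => Matrix (Fin n) (Fin n) ℂ)
      (Matrix (Fin l) (Fin l) ℂ)) (d : Fin k → Fin n → ℂ)
    (P : Fin k → Fin n → Matrix (Fin n) (Fin n) ℂ) :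
    Φ (fun i => ∑ j, d i j • P i j) =
      ∑ r : Fin k → Fin n, (∏ i, d i (r i)) • Φ (fun i => P i (r i)) := by
  rw [Φ.map_sum]
  exact Finset.sum_congr rfl fun r _ => Φ.map_smul_univ (fun i => d i (r i)) _

lemma bound_sum {n l k : ℕ} {X : Fin k → Matrix (Fin n) (Fin n) ℂ}
    {m M : ℝ} (hm : 0 < m)
    (h1 : ∀ i, (X i - m • 1).PosSemidef)
    (h2 : ∀ i, (M • (1 : Matrix (Fin n) (Fin n) ℂ) - X i).PosSemidef)
    (hX : ∀ i, (X i).IsHermitian)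
    (Φ : MultilinearMap ℂ (fun _ : Fin k => Matrix (Fin n) (Fin n) ℂ)
      (Matrix (Fin l) (Fin l) ℂ))
    (hΦpos : ∀ X : Fin k → Matrix (Fin n) (Fin n) ℂ,
      (∀ i, (X i).PosSemidef) → (Φ X).PosSemidef)
    (hΦ1 : Φ (fun _ => 1) = 1) :
    ((M ^ k + m ^ k) • (1 : Matrix (Fin l) (Fin l) ℂ) - Φ X
      - (M ^ k * m ^ k) • Φ (fun i => (X i)⁻¹)).PosSemidef ∧ (Φ X - (m ^ k) • 1).PosSemidef := by
  choose d P hP hd hone hXs hXi using fun i => spec hm (h1 i) (h2 i) (hX i)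
  have a1 : (1 : Matrix (Fin l) (Fin l) ℂ) = ∑ r : Fin k → Fin n, Φ (fun i => P i (r i)) := by
    rw [← hΦ1, ← Φ.map_sum]; congr 1; funext i; exact hone i
  have a2 : Φ X = ∑ r : Fin k → Fin n, (∏ i, d i (r i)) • Φ (fun i => P i (r i)) := by
    have : X = fun i => ∑ j, (d i j : ℂ) • P i j := funext hXs
    conv_lhs => rw [this]
    rw [expand]
    refine Finset.sum_congr rfl fun r _ => ?_
    rw [← Complex.coe_smul]; push_cast; rfl
  have a3 : Φ (fun i => (X i)⁻¹) =
      ∑ r : Fin k → Fin n, (∏ i, d i (r i))⁻¹ • Φ (fun i => P i (r i)) := by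
    have : (fun i => (X i)⁻¹) = fun i => ∑ j, ((d i j)⁻¹ : ℂ) • P i j := funext hXi
    rw [this, expand]
    refine Finset.sum_congr rfl fun r _ => ?_
    rw [← Complex.coe_smul]; push_cast; rw [Finset.prod_inv_distrib]
  have lo : ∀ r : Fin k → Fin n, m ^ k ≤ ∏ i, d i (r i) := by
    intro r
    have := Finset.prod_le_prod (s := Finset.univ) (f := fun _ : Fin k => m)
      (g := fun i => d i (r i)) (fun _ _ => hm.le) (fun i _ => (hd i (r i)).1)
    simpa using this
  have hi : ∀ r : Fin k → Fin n, ∏ i, d i (r i) ≤ M ^ k := by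
    intro r
    have := Finset.prod_le_prod (s := Finset.univ) (f := fun i => d i (r i))
      (g := fun _ : Fin k => M) (fun i _ => hm.le.trans (hd i (r i)).1) (fun i _ => (hd i (r i)).2)
    simpa using this
  have hmk : 0 < m ^ k := by positivity
  constructor
  · rw [a1, a2, a3, Finset.smul_sum, Finset.smul_sum, ← Finset.sum_sub_distrib,
      ← Finset.sum_sub_distrib]
    apply posSemidef_sum
    intro r _
    rw [smul_smul, ← sub_smul, ← sub_smul]
    apply PosSemidef.smul (hΦpos _ fun i => hP i _)
    have l1 := lo r
    have l2 := hi r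
    generalize ∏ i, d i (r i) = t at l1 l2
    have ht : 0 < t := by linarith
    have : M ^ k + m ^ k - t - M ^ k * m ^ k * t⁻¹ = (M ^ k - t) * (t - m ^ k) * t⁻¹ := by
      field_simp; ring
    rw [this]
    exact mul_nonneg (mul_nonneg (by linarith) (by linarith)) (by positivity)
  · rw [a1, a2, Finset.smul_sum, ← Finset.sum_sub_distrib]
    apply posSemidef_sum
    intro r _
    rw [← sub_smul]
    exact PosSemidef.smul (hΦpos _ fun i => hP i _) (by linarith [lo r])

/-- For accretive matrices `A₁, …, A_k` with `0 < m·I ≤ Re(Aᵢ) ≤ M·I`, `h = M/m`, and every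
normalized positive multilinear map `Φ`,
`Φ(Re(A₁⁻¹), …, Re(A_k⁻¹))² ≤ K(h^k)²·Φ(Re A₁, …, Re A_k)⁻²` in the Loewner order. -/
theorem stmt18 {n l k : ℕ} {A : Fin k → Matrix (Fin n) (Fin n) ℂ}
    (hacc : ∀ i, (matRe (A i)).PosDef)
    {m M : ℝ} (hm : 0 < m) (hmM : m ≤ M)
    (h1 : ∀ i, (matRe (A i) - m • 1).PosSemidef)
    (h2 : ∀ i, (M • (1 : Matrix (Fin n) (Fin n) ℂ) - matRe (A i)).PosSemidef)
    (Φ : MultilinearMap ℂ (fun _ : Fin k => Matrix (Fin n) (Fin n) ℂ)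
      (Matrix (Fin l) (Fin l) ℂ))
    (hΦpos : ∀ X : Fin k → Matrix (Fin n) (Fin n) ℂ,
      (∀ i, (X i).PosSemidef) → (Φ X).PosSemidef)
    (hΦ1 : Φ (fun _ => 1) = 1) :
    (kant ((M / m) ^ k) ^ 2 • ((Φ (fun i => matRe (A i)))⁻¹) ^ 2 -
      (Φ (fun i => matRe ((A i)⁻¹))) ^ 2).PosSemidef := by
  obtain ⟨b1, b2⟩ := bound_sum hm h1 h2 (fun i => (hacc i).1) Φ hΦpos hΦ1
  have hP : (Φ (fun i => matRe (A i))).PosSemidef := hΦpos _ fun i => (hacc i).posSemidef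
  have hQ : (Φ (fun i => matRe ((A i)⁻¹))).PosSemidef :=
    hΦpos _ fun i => (matRe_inv (hacc i)).1
  have hQR := mono Φ hΦpos _ _ (fun i => (matRe_inv (hacc i)).1) (fun i => (matRe_inv (hacc i)).2)
  have hM : 0 < M := by linarith
  have hmk : 0 < m ^ k := by positivity
  have hMk : 0 < M ^ k := by positivity
  have hPd : (Φ (fun i => matRe (A i))).PosDef := by
    have := (PosDef.one (n := Fin l) (R := ℂ)).smul hmk
    simpa using this.add_posSemidef b2
  generalize Φ (fun i => matRe (A i)) = P at *
  generalize Φ (fun i => matRe ((A i)⁻¹)) = Q at *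
  generalize Φ (fun i => (matRe (A i))⁻¹) = R at *
  have hK : kant ((M / m) ^ k) = (M ^ k + m ^ k) ^ 2 / (4 * (M ^ k * m ^ k)) := by
    rw [kant, div_pow]; field_simp
  rw [hK]
  generalize M ^ k = a at *
  generalize m ^ k = b at *
  have hc : 0 < a * b := by positivity
  have hs : 0 < a + b := by positivity
  have b3 : ((a + b) • (1 : Matrix (Fin l) (Fin l) ℂ) - P - (a * b) • Q).PosSemidef := by
    have := b1.add (hQR.smul hc.le)
    convert this using 1
    rw [smul_sub]; abel
  generalize a * b = c at *
  generalize a + b = s at *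
  have hk := key (A := (2 / s) • P) (B := (2 / s * c) • Q) (hP.smul (by positivity))
    (hQ.smul (by positivity)) (by
      have := b3.smul (show (0 : ℝ) ≤ 2 / s by positivity)
      rw [smul_sub, smul_sub, smul_smul, smul_smul, div_mul_cancel₀ _ hs.ne'] at this
      exact this)
  have hd : IsUnit P.det := (isUnit_iff_isUnit_det _).mp hPd.isUnit
  have h3 := (hk.mul_mul_conjTranspose_same P⁻¹).smul
    (show (0 : ℝ) ≤ (s ^ 2 / (4 * c)) ^ 2 by positivity)
  convert h3 using 1
  rw [hPd.inv.1.eq, Matrix.mul_sub, Matrix.sub_mul, Matrix.mul_one, smul_sub, ← pow_two]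
  congr 1
  have : P⁻¹ * (P * Q ^ 2 * P) * P⁻¹ = Q ^ 2 := by
    calc _ = (P⁻¹ * P) * Q ^ 2 * (P * P⁻¹) := by simp only [Matrix.mul_assoc]
      _ = Q ^ 2 := by rw [nonsing_inv_mul _ hd, mul_nonsing_inv _ hd]; simp
  simp only [smul_pow, Matrix.smul_mul, Matrix.mul_smul, smul_smul, this]
  rw [eq_comm]
  convert one_smul ℝ _ using 2
  field_simp
  try norm_num
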